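/- Let op_0 op_1 ... op_n be a valid sequence of order-2 stack operations. Then for all 0 ≤ i ≤ j ≤ n, Push2(j) = i if and only if the factor op_i op_{i+1} ... op_j belongs to the context-free language L2. -/

import Mathlib

/-- Order-2 stack operations over stack alphabet `S`. -/
inductive Op (S : Type) : Type where
  | push1 : S → Op S
  | pop1  : Op S
  | push2 : Op S
  | pop2  : Op S
  | collapse : Op S
  deriving DecidableEq

/-- Annotated stack symbol: (symbol, collapse link, position annotation). -/
abbrev ASym (S : Type) : Type := S × ℕ × ℤ
/-- Annotated order-1 stack, topmost symbol first. -/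
abbrev Stk1 (S : Type) : Type := List (ASym S)
/-- Annotated order-2 stack: list of (position annotation, order-1 stack), topmost first.
In `[[u_1][u_2] ⋯ [u_n]]` the topmost stack `u_n` comes first in the list. -/
abbrev Stk2 (S : Type) : Type := List (ℤ × Stk1 S)

/-- The initial order-2 stack `[[]]`, its unique (empty) order-1 stack annotated `-1`. -/
def initStk (S : Type) : Stk2 S := [(-1, ([] : Stk1 S))]

/-- One step of the annotated semantics; `p` is the current position.
`push1 s` records the collapse link `n-1` (number of stacks below the top) and the
position annotation `p`; `push2` duplicates the top stack annotating the copy with `p`;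
`collapse` keeps the bottom `i` order-1 stacks, where `i` is the collapse link of the
topmost symbol.  Undefined operations yield `none`. -/
def step {S : Type} (p : ℕ) (op : Op S) (W : Stk2 S) : Option (Stk2 S) :=
  match op, W with
  | .push2, t :: rest => some (((p : ℤ), t.2) :: t :: rest)
  | .pop2, _ :: t :: rest => some (t :: rest)
  | .push1 s, (a, u) :: rest => some ((a, (s, rest.length, (p : ℤ)) :: u) :: rest)
  | .pop1, (a, _ :: u) :: rest => some ((a, u) :: rest)
  | .collapse, (_, (_, i, _) :: _) :: _ =>
      if 1 ≤ i ∧ i < W.length then some (W.drop (W.length - i)) else none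
  | _, _ => none

def runFrom {S : Type} (p : ℕ) (W : Stk2 S) : List (Op S) → Option (Stk2 S)
  | [] => some W
  | op :: rest => (step p op W).bind fun W' => runFrom (p + 1) W' rest

/-- `stkAt ops j` is the annotated order-2 stack `W_j` after executing `op_0 ⋯ op_j`
(for `j = -1` this is the initial stack `[[]]`). -/
def stkAt {S : Type} (ops : List (Op S)) (j : ℤ) : Option (Stk2 S) :=
  runFrom 0 (initStk S) (ops.take (j + 1).toNat)

/-- A nonempty sequence of operations is valid if every operation is defined,
starting from the empty order-2 stack `[[]]`. -/
def Valid {S : Type} (ops : List (Op S)) : Prop :=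
  ops ≠ [] ∧ (runFrom 0 (initStk S) ops).isSome

/-- `push1At ops j` is `push1(j)`: the position annotation of the topmost symbol of the
topmost order-1 stack of `W_j`, or `-1` if that stack is empty (also `-1` for `j = -1`). -/
def push1At {S : Type} (ops : List (Op S)) (j : ℤ) : ℤ :=
  match stkAt ops j with
  | some ((_, (_, _, p) :: _) :: _) => p
  | _ => -1

/-- `Push2At ops j` is `Push2(j)`: the position annotation of the topmost order-1 stack
of `W_j` (`-1` for `j = -1`). -/
def Push2At {S : Type} (ops : List (Op S)) (j : ℤ) : ℤ :=
  match stkAt ops j with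
  | some ((a, _) :: _) => a
  | _ => -1

mutual
/-- Words derived from the nonterminal `S1` of the grammar
`S1 → ↑1 | S1 ↑2 | S1 S1 ↓1 | S1 S2 ↓2 | S1 S2 S1 ⇓`
(all letters `↑1(s)` are identified with the single letter `↑1`). -/
inductive InL1 {S : Type} : List (Op S) → Prop where
  | base (s : S) : InL1 [Op.push1 s]
  | push2 (w : List (Op S)) : InL1 w → InL1 (w ++ [Op.push2])
  | pop1 (v w : List (Op S)) : InL1 v → InL1 w → InL1 (v ++ w ++ [Op.pop1])
  | pop2 (v w : List (Op S)) : InL1 v → InL2 w → InL1 (v ++ w ++ [Op.pop2])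
  | collapse (v w x : List (Op S)) : InL1 v → InL2 w → InL1 x →
      InL1 (v ++ w ++ x ++ [Op.collapse])

/-- Words derived from the nonterminal `S2` of the grammar
`S2 → ↑2 | S2 ↑1 | S2 ↓1 | S2 S2 ↓2 | S2 S2 S1 ⇓`. -/
inductive InL2 {S : Type} : List (Op S) → Prop where
  | base : InL2 [Op.push2]
  | push1 (s : S) (w : List (Op S)) : InL2 w → InL2 (w ++ [Op.push1 s])
  | pop1 (w : List (Op S)) : InL2 w → InL2 (w ++ [Op.pop1])
  | pop2 (v w : List (Op S)) : InL2 v → InL2 w → InL2 (v ++ w ++ [Op.pop2])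
  | collapse (v w x : List (Op S)) : InL2 v → InL2 w → InL1 x →
      InL2 (v ++ w ++ x ++ [Op.collapse])
end

/-- The factor `op_i ⋯ op_j` of the sequence. -/
def factor {S : Type} (ops : List (Op S)) (i j : ℕ) : List (Op S) :=
  (ops.drop i).take (j + 1 - i)

namespace CPS

variable {S : Type}

def fac (ops : List (Op S)) (i k : ℕ) : List (Op S) := (ops.drop i).take (k - i)

theorem fac_split (ops : List (Op S)) {i m k : ℕ} (h1 : i ≤ m) (h2 : m ≤ k) :
    fac ops i k = fac ops i m ++ fac ops m k := by
  unfold fac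
  have e : k - i = (m - i) + (k - m) := by omega
  rw [e, List.take_add, List.drop_drop]
  congr 4
  omega

theorem fac_one (ops : List (Op S)) {k : ℕ} {o : Op S} (h : ops[k]? = some o) :
    fac ops k (k+1) = [o] := by
  unfold fac
  obtain ⟨hk, rfl⟩ := List.getElem?_eq_some_iff.1 h
  have e : k + 1 - k = 1 := by omega
  rw [List.drop_eq_getElem_cons hk, e, List.take_succ_cons, List.take_zero]

theorem fac_len (ops : List (Op S)) {i k : ℕ} (h : k ≤ ops.length) :
    (fac ops i k).length = k - i := by
  unfold fac
  simp
  omega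

theorem fac_succ (ops : List (Op S)) {i k : ℕ} {o : Op S} (hi : i ≤ k) (h : ops[k]? = some o) :
    fac ops i (k+1) = fac ops i k ++ [o] := by
  rw [fac_split ops hi (Nat.le_succ k), fac_one ops h]

theorem fac_last (ops : List (Op S)) {i k : ℕ} {o : Op S} {x : List (Op S)} (hi : i ≤ k)
    (hk : k < ops.length) (h : x ++ [o] = fac ops i (k+1)) :
    ops[k]? = some o ∧ x = fac ops i k := by
  have h' : ops[k]? = some ops[k] := List.getElem?_eq_getElem hk
  rw [fac_succ ops hi h'] at h
  obtain ⟨h1, h2⟩ := List.append_inj' h rfl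
  rw [h']
  simp at h2
  exact ⟨by rw [h2], h1⟩

theorem fac_app (ops : List (Op S)) {i k : ℕ} {u v : List (Op S)} (hi : i ≤ k)
    (hk : k ≤ ops.length) (hu : u ≠ []) (hv : v ≠ []) (h : u ++ v = fac ops i k) :
    ∃ m, i < m ∧ m < k ∧ u = fac ops i m ∧ v = fac ops m k := by
  have hl := congrArg List.length h
  rw [fac_len ops hk, List.length_append] at hl
  have hu' := List.length_pos_iff.2 hu
  have hv' := List.length_pos_iff.2 hv
  refine ⟨i + u.length, by omega, by omega, ?_⟩
  rw [fac_split ops (m := i + u.length) (by omega) (by omega)] at h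
  apply List.append_inj h
  rw [fac_len ops (by omega)]
  omega

theorem ne1 {w : List (Op S)} (h : InL1 w) : w ≠ [] := by cases h <;> simp
theorem ne2 {w : List (Op S)} (h : InL2 w) : w ≠ [] := by cases h <;> simp

def Rec (P1 P2 : ℕ → ℤ) (k : ℕ) : Op S → Prop
  | .push1 _ => P1 (k+1) = k ∧ P2 (k+1) = P2 k
  | .push2 => P1 (k+1) = P1 k ∧ P2 (k+1) = k
  | .pop1 => P2 (k+1) = P2 k ∧ ∃ p : ℕ, p < k ∧ P1 k = p ∧ P1 (k+1) = P1 p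
  | .pop2 => ∃ q : ℕ, q < k ∧ P2 k = q ∧ P1 (k+1) = P1 q ∧ P2 (k+1) = P2 q
  | .collapse => ∃ p : ℕ, p < k ∧ P1 k = p ∧ ∃ q : ℕ, q < p ∧ P2 p = q ∧
      P1 (k+1) = P1 q ∧ P2 (k+1) = P2 q

theorem bound (ops : List (Op S)) (P1 P2 : ℕ → ℤ) (h01 : P1 0 = -1) (h02 : P2 0 = -1)
    (R : ∀ k o, ops[k]? = some o → Rec P1 P2 k o) (k : ℕ) (hk : k ≤ ops.length) :
    P1 k < k ∧ P2 k < k := by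
  induction k using Nat.strong_induction_on with
  | _ k ih =>
  cases k with
  | zero => simp [h01, h02]
  | succ k =>
    have r := R k ops[k] (List.getElem?_eq_getElem hk)
    have i0 := ih k (by omega) (by omega)
    revert r
    cases ops[k] with
    | push1 s => rintro ⟨a, b⟩; push_cast; omega
    | push2 => rintro ⟨a, b⟩; push_cast; omega
    | pop1 =>
      rintro ⟨a, p, hp, b, c⟩
      have := ih p (by omega) (by omega)
      push_cast; omega
    | pop2 =>
      rintro ⟨p, hp, a, b, c⟩
      have := ih p (by omega) (by omega)
      push_cast; omega
    | collapse =>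
      rintro ⟨p, hp, a, q, hq, b, c, d⟩
      have := ih q (by omega) (by omega)
      push_cast; omega

theorem main (ops : List (Op S)) (P1 P2 : ℕ → ℤ) (h01 : P1 0 = -1) (h02 : P2 0 = -1)
    (R : ∀ k o, ops[k]? = some o → Rec P1 P2 k o) (k : ℕ) (hk : k ≤ ops.length) :
    ∀ i : ℕ, i < k → ((P1 k = i ↔ InL1 (fac ops i k)) ∧ (P2 k = i ↔ InL2 (fac ops i k))) := by
  have B := bound ops P1 P2 h01 h02 R
  induction k using Nat.strong_induction_on with
  | _ k ih =>
  cases k with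
  | zero => intro i hi; omega
  | succ k =>
    intro i hik
    have hik' : i ≤ k := by omega
    have F1 : ∀ m i : ℕ, m ≤ k → P1 m = i → InL1 (fac ops i m) := by
      intro m i hm h
      have := (B m (by omega)).1
      exact ((ih m (by omega) (by omega) i (by omega)).1).1 h
    have F2 : ∀ m i : ℕ, m ≤ k → P2 m = i → InL2 (fac ops i m) := by
      intro m i hm h
      have := (B m (by omega)).2
      exact ((ih m (by omega) (by omega) i (by omega)).2).1 h
    have G1 : ∀ m i : ℕ, m ≤ k → i ≤ m → InL1 (fac ops i m) → P1 m = i := by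
      intro m i hm hi h
      have hl := List.length_pos_iff.2 (ne1 h)
      rw [fac_len ops (by omega)] at hl
      exact ((ih m (by omega) (by omega) i (by omega)).1).2 h
    have G2 : ∀ m i : ℕ, m ≤ k → i ≤ m → InL2 (fac ops i m) → P2 m = i := by
      intro m i hm hi h
      have hl := List.length_pos_iff.2 (ne2 h)
      rw [fac_len ops (by omega)] at hl
      exact ((ih m (by omega) (by omega) i (by omega)).2).2 h
    have L1 : ∀ m i : ℕ, m ≤ k → P1 m = i → i < m := by
      intro m i hm h
      have := (B m (by omega)).1
      omega
    have L2 : ∀ m i : ℕ, m ≤ k → P2 m = i → i < m := by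
      intro m i hm h
      have := (B m (by omega)).2
      omega
    have ho : ops[k]? = some ops[k] := List.getElem?_eq_getElem hk
    refine ⟨⟨?_, ?_⟩, ⟨?_, ?_⟩⟩
    · intro h
      generalize ops[k] = o at ho
      have r := R k o ho
      rw [fac_succ ops hik' ho]
      cases o with
      | push1 s =>
        obtain ⟨a, b⟩ := r
        have : i = k := by omega
        subst this
        simpa [fac] using InL1.base s
      | push2 => exact InL1.push2 _ (F1 k i le_rfl (r.1 ▸ h))
      | pop1 =>
        obtain ⟨a, p, hp, b, c⟩ := r
        have := L1 p i (by omega) (c ▸ h)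
        rw [fac_split ops this.le hp.le]
        exact InL1.pop1 _ _ (F1 _ _ (by omega) (c ▸ h)) (F1 _ _ le_rfl b)
      | pop2 =>
        obtain ⟨p, hp, b, c, d⟩ := r
        have := L1 p i (by omega) (c ▸ h)
        rw [fac_split ops this.le hp.le]
        exact InL1.pop2 _ _ (F1 _ _ (by omega) (c ▸ h)) (F2 _ _ le_rfl b)
      | collapse =>
        obtain ⟨p, hp, b, q, hq, c, d, e⟩ := r
        have := L1 q i (by omega) (d ▸ h)
        rw [fac_split ops (by omega : i ≤ p) hp.le, fac_split ops this.le hq.le]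
        exact InL1.collapse _ _ _ (F1 _ _ (by omega) (d ▸ h)) (F2 _ _ (by omega) c) (F1 _ _ le_rfl b)
    · intro h
      generalize hw : fac ops i (k+1) = w at h
      cases h with
      | base s =>
        obtain ⟨e, f⟩ := fac_last ops (x := []) hik' hk hw.symm
        have hl := congrArg List.length f
        rw [fac_len ops (by omega)] at hl
        simp at hl
        have : i = k := by omega
        rw [(R k _ e).1, this]
      | push2 w h1 =>
        obtain ⟨e, rfl⟩ := fac_last ops hik' hk hw.symm
        rw [(R k _ e).1]
        exact G1 _ _ le_rfl hik' h1
      | pop1 v w h1 h2 =>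
        obtain ⟨e, f⟩ := fac_last ops hik' hk hw.symm
        obtain ⟨m, hm1, hm2, rfl, rfl⟩ := fac_app ops hik' (by omega) (ne1 h1) (ne1 h2) f
        obtain ⟨a, p, hp, b, c⟩ := R k _ e
        have := G1 _ _ le_rfl hm2.le h2
        have : p = m := by omega
        subst this
        rw [c]
        exact G1 _ _ hm2.le hm1.le h1
      | pop2 v w h1 h2 =>
        obtain ⟨e, f⟩ := fac_last ops hik' hk hw.symm
        obtain ⟨m, hm1, hm2, rfl, rfl⟩ := fac_app ops hik' (by omega) (ne1 h1) (ne2 h2) f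
        obtain ⟨p, hp, b, c, d⟩ := R k _ e
        have := G2 _ _ le_rfl hm2.le h2
        have : p = m := by omega
        subst this
        rw [c]
        exact G1 _ _ hm2.le hm1.le h1
      | collapse v w x h1 h2 h3 =>
        obtain ⟨e, f⟩ := fac_last ops hik' hk hw.symm
        obtain ⟨m, hm1, hm2, f', rfl⟩ := fac_app ops hik' (by omega) (by simp [ne1 h1]) (ne1 h3) f
        obtain ⟨l, hl1, hl2, rfl, rfl⟩ := fac_app ops hm1.le (by omega) (ne1 h1) (ne2 h2) f'
        obtain ⟨p, hp, b, q, hq, c, d, _⟩ := R k _ e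
        have := G1 _ _ le_rfl hm2.le h3
        have : p = m := by omega
        subst this
        have := G2 _ _ hm2.le hl2.le h2
        have : q = l := by omega
        subst this
        rw [d]
        exact G1 _ _ (by omega) hl1.le h1
    · intro h
      generalize ops[k] = o at ho
      have r := R k o ho
      rw [fac_succ ops hik' ho]
      cases o with
      | push2 =>
        obtain ⟨a, b⟩ := r
        have : i = k := by omega
        subst this
        simpa [fac] using InL2.base
      | push1 s => exact InL2.push1 _ _ (F2 k i le_rfl (r.2 ▸ h))
      | pop1 => exact InL2.pop1 _ (F2 k i le_rfl (r.1 ▸ h))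
      | pop2 =>
        obtain ⟨p, hp, b, c, d⟩ := r
        have := L2 p i (by omega) (d ▸ h)
        rw [fac_split ops this.le hp.le]
        exact InL2.pop2 _ _ (F2 _ _ (by omega) (d ▸ h)) (F2 _ _ le_rfl b)
      | collapse =>
        obtain ⟨p, hp, b, q, hq, c, d, e⟩ := r
        have := L2 q i (by omega) (e ▸ h)
        rw [fac_split ops (by omega : i ≤ p) hp.le, fac_split ops this.le hq.le]
        exact InL2.collapse _ _ _ (F2 _ _ (by omega) (e ▸ h)) (F2 _ _ (by omega) c) (F1 _ _ le_rfl b)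
    · intro h
      generalize hw : fac ops i (k+1) = w at h
      cases h with
      | base =>
        obtain ⟨e, f⟩ := fac_last ops (x := []) hik' hk hw.symm
        have hl := congrArg List.length f
        rw [fac_len ops (by omega)] at hl
        simp at hl
        have : i = k := by omega
        rw [(R k _ e).2, this]
      | push1 s w h1 =>
        obtain ⟨e, rfl⟩ := fac_last ops hik' hk hw.symm
        rw [(R k _ e).2]
        exact G2 _ _ le_rfl hik' h1
      | pop1 w h1 =>
        obtain ⟨e, rfl⟩ := fac_last ops hik' hk hw.symm
        rw [(R k _ e).1]
        exact G2 _ _ le_rfl hik' h1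
      | pop2 v w h1 h2 =>
        obtain ⟨e, f⟩ := fac_last ops hik' hk hw.symm
        obtain ⟨m, hm1, hm2, rfl, rfl⟩ := fac_app ops hik' (by omega) (ne2 h1) (ne2 h2) f
        obtain ⟨p, hp, b, c, d⟩ := R k _ e
        have := G2 _ _ le_rfl hm2.le h2
        have : p = m := by omega
        subst this
        rw [d]
        exact G2 _ _ hm2.le hm1.le h1
      | collapse v w x h1 h2 h3 =>
        obtain ⟨e, f⟩ := fac_last ops hik' hk hw.symm
        obtain ⟨m, hm1, hm2, f', rfl⟩ := fac_app ops hik' (by omega) (by simp [ne2 h1]) (ne1 h3) f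
        obtain ⟨l, hl1, hl2, rfl, rfl⟩ := fac_app ops hm1.le (by omega) (ne2 h1) (ne2 h2) f'
        obtain ⟨p, hp, b, q, hq, c, _, d⟩ := R k _ e
        have := G1 _ _ le_rfl hm2.le h3
        have : p = m := by omega
        subst this
        have := G2 _ _ hm2.le hl2.le h2
        have : q = l := by omega
        subst this
        rw [d]
        exact G2 _ _ (by omega) hl1.le h1

/-! Semantics -/

def T (ops : List (Op S)) (k : ℕ) : Option (Stk2 S) := runFrom 0 (initStk S) (ops.take k)

theorem runFrom_append (a b : List (Op S)) (p : ℕ) (W : Stk2 S) :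
    runFrom p W (a ++ b) = (runFrom p W a).bind fun W' => runFrom (p + a.length) W' b := by
  induction a generalizing p W with
  | nil => simp [runFrom]
  | cons o a ih =>
    simp only [List.cons_append, runFrom, List.length_cons]
    cases step p o W with
    | none => rfl
    | some W' =>
      simp only [Option.bind_some, ih]
      congr 1
      funext W''
      congr 1
      omega

theorem T_succ (ops : List (Op S)) (k : ℕ) (o : Op S) (h : ops[k]? = some o) :
    T ops (k+1) = (T ops k).bind (step k o) := by
  unfold T
  obtain ⟨hk, rfl⟩ := List.getElem?_eq_some_iff.1 h
  rw [List.take_succ_eq_append_getElem hk, runFrom_append]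
  congr 1
  funext W
  have : (ops.take k).length = k := by simp; omega
  rw [this]
  simp [runFrom]

theorem T_some (ops : List (Op S)) (hv : Valid ops) (k : ℕ) : ∃ W, T ops k = some W := by
  have h := hv.2
  rw [← List.take_append_drop k ops, runFrom_append] at h
  unfold T
  cases hh : runFrom 0 (initStk S) (ops.take k) with
  | none => rw [hh] at h; simp at h
  | some W => exact ⟨W, rfl⟩

/-- Invariant: every suffix of the stack has the expected origin. -/
def Inv (T : ℕ → Option (Stk2 S)) (k : ℕ) (W : Stk2 S) : Prop :=
  W ≠ [] ∧ ∀ a u rest, (a, u) :: rest <:+ W →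
    ((rest = [] ∧ a = -1) ∨ ∃ q : ℕ, q < k ∧ a = q ∧ T q = some rest) ∧
    ∀ s l x u', (s, l, x) :: u' <:+ u → ∃ p : ℕ, p < k ∧ x = p ∧ ∃ b r',
      T p = some ((b, u') :: r') ∧ r'.length = l ∧ r' <:+ rest

theorem Inv.suffix {T : ℕ → Option (Stk2 S)} {k : ℕ} {W W' : Stk2 S} (h : Inv T k W)
    (hs : W' <:+ W) (hne : W' ≠ []) : Inv T k W' :=
  ⟨hne, fun a u rest hh => h.2 a u rest (hh.trans hs)⟩

theorem Inv.mono {T : ℕ → Option (Stk2 S)} {k k' : ℕ} {W : Stk2 S} (h : Inv T k W)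
    (hk : k ≤ k') : Inv T k' W := by
  refine ⟨h.1, fun a u rest hh => ?_⟩
  obtain ⟨h1, h2⟩ := h.2 a u rest hh
  constructor
  · rcases h1 with h1 | ⟨q, hq, h1⟩
    · exact Or.inl h1
    · exact Or.inr ⟨q, by omega, h1⟩
  · intro s l x u' hs
    obtain ⟨p, hp, h3⟩ := h2 s l x u' hs
    exact ⟨p, by omega, h3⟩

theorem Inv.step {T : ℕ → Option (Stk2 S)} {k : ℕ} {W W' : Stk2 S} (o : Op S) (h : Inv T k W)
    (hT : T k = some W) (hs : step k o W = some W') : Inv T (k+1) W' := by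
  obtain _ | ⟨⟨a, u⟩, rest⟩ := W
  · exact absurd rfl h.1
  have hm := h.mono (Nat.le_succ k)
  cases o with
  | push1 s =>
    simp only [_root_.step, Option.some.injEq] at hs
    subst hs
    refine ⟨by simp, fun a' u₁ rest' hh => ?_⟩
    rcases List.suffix_cons_iff.1 hh with e | e
    · simp only [List.cons.injEq, Prod.mk.injEq] at e
      obtain ⟨⟨rfl, rfl⟩, rfl⟩ := e
      obtain ⟨h1, h2⟩ := hm.2 a' u rest' List.suffix_rfl
      refine ⟨h1, fun s' l x u' hu => ?_⟩
      rcases List.suffix_cons_iff.1 hu with e | e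
      · simp only [List.cons.injEq, Prod.mk.injEq] at e
        obtain ⟨⟨rfl, rfl, rfl⟩, rfl⟩ := e
        exact ⟨k, by omega, rfl, a', rest', hT, rfl, List.suffix_rfl⟩
      · exact h2 s' l x u' e
    · exact hm.2 a' u₁ rest' (e.trans (List.suffix_cons _ _))
  | pop1 =>
    obtain _ | ⟨c, u⟩ := u
    · simp [_root_.step] at hs
    simp only [_root_.step, Option.some.injEq] at hs
    subst hs
    refine ⟨by simp, fun a' u₁ rest' hh => ?_⟩
    rcases List.suffix_cons_iff.1 hh with e | e
    · simp only [List.cons.injEq, Prod.mk.injEq] at e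
      obtain ⟨⟨rfl, rfl⟩, rfl⟩ := e
      obtain ⟨h1, h2⟩ := hm.2 a' (c :: u₁) rest' List.suffix_rfl
      exact ⟨h1, fun s' l x u' hu => h2 s' l x u' (hu.trans (List.suffix_cons _ _))⟩
    · exact hm.2 a' u₁ rest' (e.trans (List.suffix_cons _ _))
  | push2 =>
    simp only [_root_.step, Option.some.injEq] at hs
    subst hs
    refine ⟨by simp, fun a' u₁ rest' hh => ?_⟩
    rcases List.suffix_cons_iff.1 hh with e | e
    · simp only [List.cons.injEq, Prod.mk.injEq] at e
      obtain ⟨⟨rfl, rfl⟩, rfl⟩ := e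
      obtain ⟨h1, h2⟩ := hm.2 a u₁ rest List.suffix_rfl
      refine ⟨Or.inr ⟨k, by omega, rfl, hT⟩, fun s' l x u' hu => ?_⟩
      obtain ⟨p, hp, hx, b, r', h3, h4, h5⟩ := h2 s' l x u' hu
      exact ⟨p, hp, hx, b, r', h3, h4, h5.trans (List.suffix_cons _ _)⟩
    · exact hm.2 a' u₁ rest' e
  | pop2 =>
    obtain _ | ⟨t, rest⟩ := rest
    · simp [_root_.step] at hs
    simp only [_root_.step, Option.some.injEq] at hs
    subst hs
    exact hm.suffix (List.suffix_cons _ _) (by simp)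
  | collapse =>
    obtain _ | ⟨⟨s, i, x⟩, u⟩ := u
    · simp [_root_.step] at hs
    simp only [_root_.step] at hs
    split_ifs at hs with hc
    simp only [Option.some.injEq] at hs
    subst hs
    refine hm.suffix (List.drop_suffix _ _) ?_
    rw [← List.length_pos_iff, List.length_drop]
    omega

theorem T_inv (ops : List (Op S)) (k : ℕ) (hk : k ≤ ops.length) (W : Stk2 S)
    (h : T ops k = some W) : Inv (T ops) k W := by
  induction k generalizing W with
  | zero =>
    simp only [T, List.take_zero, runFrom, Option.some.injEq] at h
    subst h
    refine ⟨by simp [initStk], fun a u rest hh => ?_⟩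
    unfold initStk at hh
    rcases List.suffix_cons_iff.1 hh with e | e
    · simp only [List.cons.injEq, Prod.mk.injEq] at e
      obtain ⟨⟨rfl, rfl⟩, rfl⟩ := e
      simp
    · simp at e
  | succ k ih =>
    rw [T_succ ops k ops[k] (List.getElem?_eq_getElem hk), Option.bind_eq_some_iff] at h
    obtain ⟨V, hV, hs⟩ := h
    exact (ih (by omega) V hV).step _ hV hs

def top1 : Option (Stk2 S) → ℤ
  | some ((_, (_, _, p) :: _) :: _) => p
  | _ => -1

def top2 : Option (Stk2 S) → ℤ
  | some ((a, _) :: _) => a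
  | _ => -1

theorem top1_congr (a b : ℤ) (u : Stk1 S) (r r' : Stk2 S) :
    top1 (some ((a, u) :: r)) = top1 (some ((b, u) :: r')) := by
  cases u <;> rfl

theorem recs (ops : List (Op S)) (hv : Valid ops) (k : ℕ) (o : Op S) (ho : ops[k]? = some o) :
    Rec (fun k => top1 (T ops k)) (fun k => top2 (T ops k)) k o := by
  obtain ⟨hk, -⟩ := List.getElem?_eq_some_iff.1 ho
  obtain ⟨W, hW⟩ := T_some ops hv k
  obtain ⟨W', hW'⟩ := T_some ops hv (k+1)
  have hI := T_inv ops k hk.le W hW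
  have hs := hW'
  rw [T_succ ops k o ho, hW, Option.bind_some] at hs
  obtain _ | ⟨⟨a, u⟩, rest⟩ := W
  · exact absurd rfl hI.1
  cases o with
  | push1 s =>
    simp only [step, Option.some.injEq] at hs
    subst hs
    simp [Rec, hW', hW, top1, top2]
  | push2 =>
    simp only [step, Option.some.injEq] at hs
    subst hs
    simp only [Rec, hW', hW]
    exact ⟨top1_congr _ _ _ _ _, rfl⟩
  | pop1 =>
    obtain _ | ⟨⟨s, l, x⟩, u⟩ := u
    · simp [step] at hs
    simp only [step, Option.some.injEq] at hs
    subst hs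
    obtain ⟨p, hp, rfl, b, r', h1, -, -⟩ :=
      (hI.2 _ _ _ List.suffix_rfl).2 s l x u List.suffix_rfl
    simp only [Rec, hW', hW]
    refine ⟨rfl, p, hp, rfl, ?_⟩
    rw [h1]
    exact top1_congr _ _ _ _ _
  | pop2 =>
    obtain _ | ⟨t, rest⟩ := rest
    · simp [step] at hs
    simp only [step, Option.some.injEq] at hs
    subst hs
    rcases (hI.2 _ _ _ List.suffix_rfl).1 with ⟨h1, -⟩ | ⟨q, hq, rfl, h1⟩
    · simp at h1
    simp only [Rec, hW', hW]
    refine ⟨q, hq, rfl, ?_⟩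
    rw [h1]
    exact ⟨rfl, rfl⟩
  | collapse =>
    obtain _ | ⟨⟨s, i, x⟩, u⟩ := u
    · simp [step] at hs
    simp only [step] at hs
    split_ifs at hs with hc
    simp only [Option.some.injEq] at hs
    obtain ⟨p, hp, rfl, b, r', h1, h2, h3⟩ :=
      (hI.2 _ _ _ List.suffix_rfl).2 s i x u List.suffix_rfl
    have h4 := List.suffix_iff_eq_drop.1 (h3.trans (List.suffix_cons (a, (s, i, (p : ℤ)) :: u) rest))
    rw [h2, hs] at h4
    subst h4
    have hI' := T_inv ops p (by omega) _ h1
    rcases (hI'.2 _ _ _ List.suffix_rfl).1 with ⟨h5, -⟩ | ⟨q, hq, rfl, h5⟩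
    · subst h5
      simp at h2
      omega
    simp only [Rec, hW', hW]
    refine ⟨p, hp, rfl, q, hq, ?_⟩
    rw [h1, h5]
    exact ⟨rfl, rfl, rfl⟩

end CPS

/-- For a valid sequence `op_0 ⋯ op_n` of order-2 stack operations and all
`0 ≤ i ≤ j ≤ n`: `Push2(j) = i` iff the factor `op_i ⋯ op_j` belongs to `L2`. -/
theorem Push2_eq_iff_mem_L2 {S : Type} (ops : List (Op S)) (hv : Valid ops)
    (i j : ℕ) (hij : i ≤ j) (hj : j < ops.length) :
    Push2At ops (j : ℤ) = (i : ℤ) ↔ InL2 (factor ops i j) := by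
  have h := (CPS.main ops (fun k => CPS.top1 (CPS.T ops k)) (fun k => CPS.top2 (CPS.T ops k))
    rfl rfl (CPS.recs ops hv) (j+1) hj i (by omega)).2
  have e : Push2At ops (j : ℤ) = CPS.top2 (CPS.T ops (j+1)) := by
    unfold Push2At stkAt CPS.T
    have : ((j : ℤ) + 1).toNat = j + 1 := by omega
    rw [this]
    rfl
  rw [e]
  exact h
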